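/- In the SVD frame setting, let ω = a₃* ∧ ⋯ ∧ a_n* (regarded as a form on V via the projection V → V₁) and set Ω = Ω₁ − Ω₂ ∧ ω. With e₁ = (a₁ + λ₁ a_{n+1})/√(1+λ₁²), e₂ = (a₂ + λ₂ a_{n+2})/√(1+λ₂²), e_{n+1} = (a_{n+1} − λ₁ a₁)/√(1+λ₁²), e_{n+2} = (a_{n+2} − λ₂ a₂)/√(1+λ₂²), one has Ω(e_{n+1}, e₂, a₃, …, a_n) = −(λ₁ + λ₂)/√((1+λ₁²)(1+λ₂²)), Ω(e₁, e_{n+2}, a₃, …, a_n) = −(λ₁ + λ₂)/√((1+λ₁²)(1+λ₂²)), and Ω(e_{n+2}, e₂, a₃, …, a_n) = Ω(e₁, e_{n+1}, a₃, …, a_n) = 0; moreover for n ≥ 3 and 3 ≤ j ≤ n, replacing the j-th argument a_j by e_{n+1} or e_{n+2} (and keeping e₁, e₂ in the first two slots) gives the value 0. -/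

import Mathlib

noncomputable section

variable {V₁ V₂ : Type*} [NormedAddCommGroup V₁] [InnerProductSpace ℝ V₁]
  [NormedAddCommGroup V₂] [InnerProductSpace ℝ V₂]

/-- The canonical inclusion of a pair into the `L²` product `V = V₁ × V₂`. -/
def toProd (x : V₁) (y : V₂) : WithLp 2 (V₁ × V₂) :=
  (WithLp.equiv 2 (V₁ × V₂)).symm (x, y)

/-- Projection `V = V₁ × V₂ → V₁`. -/
def proj₁ : WithLp 2 (V₁ × V₂) →ₗ[ℝ] V₁ :=
  (LinearMap.fst ℝ V₁ V₂).comp (WithLp.linearEquiv 2 ℝ (V₁ × V₂)).toLinearMap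

/-- Projection `V = V₁ × V₂ → V₂`. -/
def proj₂ : WithLp 2 (V₁ × V₂) →ₗ[ℝ] V₂ :=
  (LinearMap.snd ℝ V₁ V₂).comp (WithLp.linearEquiv 2 ℝ (V₁ × V₂)).toLinearMap

/-- The wedge product of a real-valued alternating `2`-form and `m`-form, an
alternating `(m+2)`-form (the sum over shuffles, i.e. the determinant convention). -/
def wedge {V : Type*} [AddCommGroup V] [Module ℝ V] {m : ℕ}
    (Ω : V [⋀^Fin 2]→ₗ[ℝ] ℝ) (ω : V [⋀^Fin m]→ₗ[ℝ] ℝ) : V [⋀^Fin (m + 2)]→ₗ[ℝ] ℝ :=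
  ((TensorProduct.lid ℝ ℝ).toLinearMap.compAlternatingMap
    (Ω.domCoprod ω)).domDomCongr (finSumFinEquiv.trans (finCongr (Nat.add_comm 2 m)))

/-- The `(n−2)`-form `a₃* ∧ ⋯ ∧ a_n*` on `V₁`. -/
def smallOmega (m : ℕ) (a : OrthonormalBasis (Fin (m + 2)) ℝ V₁) :
    V₁ [⋀^Fin m]→ₗ[ℝ] ℝ :=
  ((Pi.basisFun ℝ (Fin m)).det).compLinearMap
    (LinearMap.pi fun i : Fin m => a.toBasis.coord ⟨(i : ℕ) + 2, by omega⟩)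

lemma AlternatingMap.map_eq_zero_of_smul {ι M : Type*} [DecidableEq ι] [AddCommGroup M]
    [Module ℝ M] (f : M [⋀^ι]→ₗ[ℝ] ℝ) {x : ι → M} {i j : ι} (hij : i ≠ j) {p q : ℝ} {z : M}
    (hi : x i = p • z) (hj : x j = q • z) : f x = 0 := by
  have hx : x = Function.update (Function.update x i (p • z)) j (q • z) := by
    rw [← hi, Function.update_eq_self, ← hj, Function.update_eq_self]
  rw [hx, f.map_update_smul, Function.update_comm hij, f.map_update_smul,
    f.map_eq_zero_of_eq _ (i := i) (j := j) (by simp [hij.symm]) hij]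
  simp

lemma AlternatingMap.map_smul_smul {ι M : Type*} [DecidableEq ι] [AddCommGroup M]
    [Module ℝ M] (f : M [⋀^ι]→ₗ[ℝ] ℝ) {x y : ι → M} {i j : ι} (hij : i ≠ j) {p q : ℝ}
    (hi : x i = p • y i) (hj : x j = q • y j) (h : ∀ k, k ≠ i → k ≠ j → x k = y k) :
    f x = p * q * f y := by
  have hx : x = Function.update (Function.update y i (p • y i)) j (q • y j) := by
    funext k
    by_cases hkj : k = j
    · subst hkj; simp [hj]
    · by_cases hki : k = i
      · subst hki; simp [hi, hkj]
      · simp [hki, hkj, h k hki hkj]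
  rw [hx, f.map_update_smul, Function.update_comm hij, f.map_update_smul,
    Function.update_comm hij.symm]
  simp only [Function.update_eq_self, smul_eq_mul]
  ring

/-- If `ω` annihilates the first two arguments, only the trivial shuffle contributes to the
wedge product. -/
lemma wedge_apply_of_annihilates {V : Type*} [AddCommGroup V] [Module ℝ V] {m : ℕ}
    (Ω : V [⋀^Fin 2]→ₗ[ℝ] ℝ) (ω : V [⋀^Fin m]→ₗ[ℝ] ℝ) (v : Fin (m + 2) → V)
    (h : ∀ (u : Fin m → V) (k : Fin m) (i : Fin 2), u k = v ⟨i, by omega⟩ → ω u = 0) :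
    wedge Ω ω v =
      Ω ![v 0, v 1] * ω (fun i => v ⟨(i : ℕ) + 2, by omega⟩) := by
  have hl : ∀ i : Fin 2, (finSumFinEquiv.trans (finCongr (Nat.add_comm 2 m))) (Sum.inl i) =
      ⟨i, by omega⟩ := fun i => by ext; simp
  have hr : ∀ i : Fin m, (finSumFinEquiv.trans (finCongr (Nat.add_comm 2 m))) (Sum.inr i) =
      ⟨(i : ℕ) + 2, by omega⟩ := fun i => by ext; simp
  unfold wedge
  rw [AlternatingMap.domDomCongr_apply, LinearMap.compAlternatingMap_apply]
  generalize finSumFinEquiv.trans (finCongr (Nat.add_comm 2 m)) = E at hl hr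
  have hsum : (Ω.domCoprod ω) (v ∘ E) =
      ∑ σ, AlternatingMap.domCoprod.summand Ω ω σ (v ∘ E) := by
    rw [← sum_apply, ← AlternatingMap.domCoprod_coe]
    rfl
  rw [hsum, LinearEquiv.coe_coe, map_sum]
  refine (Finset.sum_eq_single
    (Quotient.mk'' 1 : Equiv.Perm.ModSumCongr (Fin 2) (Fin m)) ?_ ?_).trans ?_
  rotate_left 2
  · rw [AlternatingMap.domCoprod.summand_mk'']
    simp only [Equiv.Perm.sign_one, one_smul, MultilinearMap.domDomCongr_apply,
      MultilinearMap.domCoprod_apply, Equiv.Perm.coe_one, id_eq, Function.comp_apply, hl, hr,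
      AlternatingMap.coe_multilinearMap, TensorProduct.lid_tmul, smul_eq_mul]
    congr 2
    funext i
    fin_cases i <;> rfl
  · intro σ _ hσ
    induction σ using Quotient.inductionOn' with | _ σ
    have hex : ∃ (k : Fin m) (i : Fin 2), σ (Sum.inr k) = Sum.inl i := by
      by_contra! hno
      apply hσ
      refine Quotient.sound' (QuotientGroup.leftRel_apply.mpr ?_)
      rw [mul_one]
      apply Subgroup.inv_mem
      rw [← Subgroup.inv_mem_iff]
      apply Equiv.Perm.mem_sumCongrHom_range_of_perm_mapsTo_inl
      rintro _ ⟨i, rfl⟩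
      rcases hk : σ⁻¹ (Sum.inl i) with i' | k
      · exact ⟨i', rfl⟩
      · exact absurd (Equiv.Perm.inv_eq_iff_eq.mp hk).symm (hno k i)
    obtain ⟨k, i, hki⟩ := hex
    rw [AlternatingMap.domCoprod.summand_mk'']
    simp only [smul_apply, MultilinearMap.domDomCongr_apply,
      MultilinearMap.domCoprod_apply, AlternatingMap.coe_multilinearMap]
    rw [h _ k i (by simp [hki, hl]), TensorProduct.tmul_zero, smul_zero, map_zero]
  · simp

lemma smallOmega_eq_zero (m : ℕ) (a : OrthonormalBasis (Fin (m + 2)) ℝ V₁) {u : Fin m → V₁}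
    {k : Fin m} {i : Fin (m + 2)} (hi : (i : ℕ) < 2) {p : ℝ} (hu : u k = p • a i) :
    smallOmega m a u = 0 := by
  unfold smallOmega
  rw [AlternatingMap.compLinearMap_apply]
  apply AlternatingMap.map_coord_zero _ k
  funext l
  have hne : i ≠ ⟨(l : ℕ) + 2, by omega⟩ := by
    intro h
    rw [h] at hi
    simp at hi
  simp [hu, hne]

lemma smallOmega_self (m : ℕ) (a : OrthonormalBasis (Fin (m + 2)) ℝ V₁) :
    smallOmega m a (fun i => a ⟨(i : ℕ) + 2, by omega⟩) = 1 := by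
  unfold smallOmega
  rw [AlternatingMap.compLinearMap_apply]
  convert! (Pi.basisFun ℝ (Fin m)).det_self using 2
  funext k l
  simp [Pi.single_apply, Fin.ext_iff, eq_comm]

@[simp] lemma proj₁_smul_toProd (c : ℝ) (x : V₁) (y : V₂) :
    proj₁ (c • toProd x y) = c • x := rfl

@[simp] lemma proj₂_smul_toProd (c : ℝ) (x : V₁) (y : V₂) :
    proj₂ (c • toProd x y) = c • y := rfl

@[simp] lemma proj₁_toProd (x : V₁) (y : V₂) : proj₁ (toProd x y) = x := rfl

/-- The wedge term reduces to a product when the first two arguments project to multiples of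
the first two basis vectors. -/
lemma wedge_smallOmega_apply (m : ℕ) (a : OrthonormalBasis (Fin (m + 2)) ℝ V₁)
    (β : V₂ [⋀^Fin 2]→ₗ[ℝ] ℝ) (v : Fin (m + 2) → WithLp 2 (V₁ × V₂))
    (h : ∀ i : Fin 2, ∃ (c : ℝ) (k : Fin (m + 2)),
      (k : ℕ) < 2 ∧ proj₁ (v ⟨i, by omega⟩) = c • a k) :
    wedge (β.compLinearMap proj₂) ((smallOmega m a).compLinearMap proj₁) v =
      β ![proj₂ (v 0), proj₂ (v 1)] *
        smallOmega m a (fun i => proj₁ (v ⟨(i : ℕ) + 2, by omega⟩)) := by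
  rw [wedge_apply_of_annihilates]
  · simp only [AlternatingMap.compLinearMap_apply]
    congr 2
    funext i
    fin_cases i <;> rfl
  · intro u k i hu
    obtain ⟨c, l, hl, hc⟩ := h i
    rw [AlternatingMap.compLinearMap_apply]
    exact smallOmega_eq_zero m a (k := k) hl (by rw [← hc, ← hu])

lemma OrthonormalBasis.det_smul_smul (b : OrthonormalBasis (Fin 2) ℝ V₂) (s t : ℝ) :
    b.toBasis.det ![s • b 0, t • b 1] = s * t := by
  simp [Module.Basis.det_apply, Matrix.det_fin_two, Module.Basis.toMatrix_apply]

/-- The form `Ω₁ - Ω₂ ∧ ω` on arguments that project to multiples of `a₁, a₂` in the first two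
slots and to `a₃, …, a_n` afterwards. -/
lemma det_sub_wedge_apply (m : ℕ) (a : OrthonormalBasis (Fin (m + 2)) ℝ V₁)
    (β : V₂ [⋀^Fin 2]→ₗ[ℝ] ℝ) (v : Fin (m + 2) → WithLp 2 (V₁ × V₂)) {p q : ℝ}
    (h₀ : proj₁ (v 0) = p • a 0)
    (h₁ : proj₁ (v 1) = q • a 1)
    (h : ∀ i : Fin (m + 2), 2 ≤ (i : ℕ) → proj₁ (v i) = a i) :
    ((a.toBasis.det.compLinearMap proj₁ : WithLp 2 (V₁ × V₂) [⋀^Fin (m + 2)]→ₗ[ℝ] ℝ) -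
      wedge (β.compLinearMap proj₂) ((smallOmega m a).compLinearMap proj₁)) v =
      p * q - β ![proj₂ (v 0), proj₂ (v 1)] := by
  have hdet : a.toBasis.det (fun i => proj₁ (v i)) = p * q * a.toBasis.det a.toBasis := by
    apply AlternatingMap.map_smul_smul (i := 0) (j := 1) _ (by simp)
      (by simpa using h₀) (by simpa using h₁)
    intro k hk₀ hk₁
    rw [h k (by simp only [ne_eq, Fin.ext_iff, Fin.val_zero, Fin.val_one] at hk₀ hk₁; omega)]
    simp
  have hω : (fun i : Fin m => proj₁ (v ⟨(i : ℕ) + 2, by omega⟩)) =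
      fun i : Fin m => a ⟨(i : ℕ) + 2, by omega⟩ := funext fun i => h _ (by simp)
  rw [AlternatingMap.sub_apply, AlternatingMap.compLinearMap_apply, hdet,
    Module.Basis.det_self, wedge_smallOmega_apply, hω, smallOmega_self]
  · ring
  · intro i
    fin_cases i
    exacts [⟨p, _, by simp, h₀⟩, ⟨q, _, by simp, h₁⟩]

/-- The form `Ω₁ - Ω₂ ∧ ω` vanishes if two arguments have parallel projections to `V₁` and one
factor of the wedge term is zero. -/
lemma det_sub_wedge_eq_zero (m : ℕ) (a : OrthonormalBasis (Fin (m + 2)) ℝ V₁)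
    (β : V₂ [⋀^Fin 2]→ₗ[ℝ] ℝ) (v : Fin (m + 2) → WithLp 2 (V₁ × V₂))
    (h : ∀ i : Fin 2, ∃ (c : ℝ) (k : Fin (m + 2)),
      (k : ℕ) < 2 ∧ proj₁ (v ⟨i, by omega⟩) = c • a k)
    {i j : Fin (m + 2)} (hij : i ≠ j) {p q : ℝ} {z : V₁}
    (hi : proj₁ (v i) = p • z) (hj : proj₁ (v j) = q • z)
    (hw : β ![proj₂ (v 0), proj₂ (v 1)] = 0 ∨
      smallOmega m a (fun i => proj₁ (v ⟨(i : ℕ) + 2, by omega⟩)) = 0) :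
    ((a.toBasis.det.compLinearMap proj₁ : WithLp 2 (V₁ × V₂) [⋀^Fin (m + 2)]→ₗ[ℝ] ℝ) -
      wedge (β.compLinearMap proj₂) ((smallOmega m a).compLinearMap proj₁)) v = 0 := by
  rw [AlternatingMap.sub_apply, AlternatingMap.compLinearMap_apply,
    AlternatingMap.map_eq_zero_of_smul _ hij hi hj, wedge_smallOmega_apply m a β v h,
    mul_eq_zero.mpr hw, sub_zero]

/-- In the SVD frame setting, with `ω = a₃* ∧ ⋯ ∧ a_n*` and `Ω = Ω₁ − Ω₂ ∧ ω`:
`Ω(e_{n+1}, e₂, a₃, …) = Ω(e₁, e_{n+2}, a₃, …) = −(λ₁+λ₂)/√((1+λ₁²)(1+λ₂²))`,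
`Ω(e_{n+2}, e₂, a₃, …) = Ω(e₁, e_{n+1}, a₃, …) = 0`, and replacing a later slot
`a_j` (`j ≥ 3`) by `e_{n+1}` or `e_{n+2}` gives `0`. -/
theorem omega_eval_normal_replacements (m : ℕ)
    (a : OrthonormalBasis (Fin (m + 2)) ℝ V₁) (b : OrthonormalBasis (Fin 2) ℝ V₂)
    (l₁ l₂ : ℝ)
    (e : Fin (m + 2) → WithLp 2 (V₁ × V₂))
    (he₀ : e ⟨0, by omega⟩ =
      (Real.sqrt (1 + l₁ ^ 2))⁻¹ • toProd (a ⟨0, by omega⟩) (l₁ • b 0))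
    (he₁ : e ⟨1, by omega⟩ =
      (Real.sqrt (1 + l₂ ^ 2))⁻¹ • toProd (a ⟨1, by omega⟩) (l₂ • b 1))
    (he : ∀ i : Fin (m + 2), 2 ≤ (i : ℕ) → e i = toProd (a i) 0)
    (eN : Fin 2 → WithLp 2 (V₁ × V₂))
    (heN₀ : eN 0 =
      (Real.sqrt (1 + l₁ ^ 2))⁻¹ • toProd (-(l₁ • a ⟨0, by omega⟩)) (b 0))
    (heN₁ : eN 1 =
      (Real.sqrt (1 + l₂ ^ 2))⁻¹ • toProd (-(l₂ • a ⟨1, by omega⟩)) (b 1))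
    (Ω : WithLp 2 (V₁ × V₂) [⋀^Fin (m + 2)]→ₗ[ℝ] ℝ)
    (hΩ : Ω = (a.toBasis.det.compLinearMap proj₁ :
        WithLp 2 (V₁ × V₂) [⋀^Fin (m + 2)]→ₗ[ℝ] ℝ) -
      wedge (b.toBasis.det.compLinearMap proj₂)
        ((smallOmega m a).compLinearMap proj₁)) :
    Ω (Function.update e ⟨0, by omega⟩ (eN 0)) =
        -(l₁ + l₂) / Real.sqrt ((1 + l₁ ^ 2) * (1 + l₂ ^ 2)) ∧
    Ω (Function.update e ⟨1, by omega⟩ (eN 1)) =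
        -(l₁ + l₂) / Real.sqrt ((1 + l₁ ^ 2) * (1 + l₂ ^ 2)) ∧
    Ω (Function.update e ⟨0, by omega⟩ (eN 1)) = 0 ∧
    Ω (Function.update e ⟨1, by omega⟩ (eN 0)) = 0 ∧
    ∀ j : Fin (m + 2), 2 ≤ (j : ℕ) →
      Ω (Function.update e j (eN 0)) = 0 ∧ Ω (Function.update e j (eN 1)) = 0 := by
  subst hΩ
  simp only [Fin.mk_zero, Fin.mk_one] at he₀ he₁ heN₀ heN₁ ⊢
  rw [Real.sqrt_mul (by positivity)]
  have hs : Real.sqrt (1 + l₁ ^ 2) ≠ 0 := by positivity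
  have ht : Real.sqrt (1 + l₂ ^ 2) ≠ 0 := by positivity
  generalize Real.sqrt (1 + l₁ ^ 2) = s at *
  generalize Real.sqrt (1 + l₂ ^ 2) = t at *
  have hne : (0 : Fin (m + 2)) ≠ 1 := by simp
  have hp₀ : proj₁ (e 0) = s⁻¹ • a 0 := by
    rw [he₀, proj₁_smul_toProd]
  have hp₁ : proj₁ (e 1) = t⁻¹ • a 1 := by
    rw [he₁, proj₁_smul_toProd]
  have hpN₀ : proj₁ (eN 0) = -(s⁻¹ * l₁) • a 0 := by
    rw [heN₀, proj₁_smul_toProd, smul_neg, smul_smul, neg_smul]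
  have hpN₁ : proj₁ (eN 1) = -(t⁻¹ * l₂) • a 1 := by
    rw [heN₁, proj₁_smul_toProd, smul_neg, smul_smul, neg_smul]
  have hq₀ : proj₂ (e 0) = (s⁻¹ * l₁) • b 0 := by
    rw [he₀, proj₂_smul_toProd, smul_smul]
  have hq₁ : proj₂ (e 1) = (t⁻¹ * l₂) • b 1 := by
    rw [he₁, proj₂_smul_toProd, smul_smul]
  have hqN₀ : proj₂ (eN 0) = s⁻¹ • b 0 := by rw [heN₀, proj₂_smul_toProd]
  have hqN₁ : proj₂ (eN 1) = t⁻¹ • b 1 := by rw [heN₁, proj₂_smul_toProd]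
  have hrest : ∀ i : Fin (m + 2), 2 ≤ (i : ℕ) → proj₁ (e i) = a i := fun i hi => by
    rw [he i hi, proj₁_toProd]
  have hne₀ : ∀ i : Fin (m + 2), 2 ≤ (i : ℕ) → i ≠ 0 := by
    rintro i hi rfl
    simp at hi
  have hne₁ : ∀ i : Fin (m + 2), 2 ≤ (i : ℕ) → i ≠ 1 := by
    rintro i hi rfl
    simp at hi
  refine ⟨?_, ?_, ?_, ?_, fun j hj => ?_⟩
  · rw [det_sub_wedge_apply m a _ _
      (by rw [Function.update_self]; exact hpN₀)
      (by rw [Function.update_of_ne hne.symm]; exact hp₁)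
      (fun i hi => by rw [Function.update_of_ne (hne₀ i hi)]; exact hrest i hi),
      Function.update_self, Function.update_of_ne hne.symm, hqN₀, hq₁,
      OrthonormalBasis.det_smul_smul]
    field_simp
    ring
  · rw [det_sub_wedge_apply m a _ _
      (by rw [Function.update_of_ne hne]; exact hp₀)
      (by rw [Function.update_self]; exact hpN₁)
      (fun i hi => by rw [Function.update_of_ne (hne₁ i hi)]; exact hrest i hi),
      Function.update_self, Function.update_of_ne hne, hqN₁, hq₀,
      OrthonormalBasis.det_smul_smul]
    field_simp
    ring
  · have h₀ := Function.update_self (0 : Fin (m + 2)) (eN 1) e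
    have h₁ := Function.update_of_ne hne.symm (eN 1) e
    refine det_sub_wedge_eq_zero m a _ _ ?_ hne (by rw [h₀, hpN₁]) (by rw [h₁, hp₁]) (Or.inl ?_)
    · intro i
      fin_cases i
      exacts [⟨_, _, by simp, (congrArg proj₁ h₀).trans hpN₁⟩,
        ⟨_, _, by simp, (congrArg proj₁ h₁).trans hp₁⟩]
    · rw [h₀, h₁, hqN₁, hq₁]
      exact AlternatingMap.map_eq_zero_of_smul _ (i := 0) (j := 1) (by simp) rfl rfl
  · have h₀ := Function.update_of_ne hne (eN 0) e
    have h₁ := Function.update_self (1 : Fin (m + 2)) (eN 0) e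
    refine det_sub_wedge_eq_zero m a _ _ ?_ hne (by rw [h₀, hp₀]) (by rw [h₁, hpN₀]) (Or.inl ?_)
    · intro i
      fin_cases i
      exacts [⟨_, _, by simp, (congrArg proj₁ h₀).trans hp₀⟩,
        ⟨_, _, by simp, (congrArg proj₁ h₁).trans hpN₀⟩]
    · rw [h₀, h₁, hqN₀, hq₀]
      exact AlternatingMap.map_eq_zero_of_smul _ (i := 0) (j := 1) (by simp) rfl rfl
  · have hv₀ := fun x => Function.update_of_ne (hne₀ j hj).symm x e
    have hv₁ := fun x => Function.update_of_ne (hne₁ j hj).symm x e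
    have hvj := fun x => Function.update_self j x e
    have hj' : (⟨((⟨j - 2, by omega⟩ : Fin m) : ℕ) + 2, by simp; omega⟩ : Fin (m + 2)) = j := by
      ext
      simp only
      omega
    have hspan : ∀ (x : WithLp 2 (V₁ × V₂)) (i : Fin 2), ∃ (c : ℝ) (k : Fin (m + 2)),
        (k : ℕ) < 2 ∧ proj₁ (Function.update e j x ⟨i, by omega⟩) = c • a k := by
      intro x i
      fin_cases i
      exacts [⟨_, _, by simp, (congrArg proj₁ (hv₀ x)).trans hp₀⟩,
        ⟨_, _, by simp, (congrArg proj₁ (hv₁ x)).trans hp₁⟩]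
    constructor
    · exact det_sub_wedge_eq_zero m a _ _ (hspan _) (hne₀ j hj).symm (by rw [hv₀, hp₀])
        (by rw [hvj, hpN₀])
        (Or.inr (smallOmega_eq_zero m a (k := ⟨j - 2, by omega⟩) (i := 0) (by simp)
          (by rw [hj', hvj, hpN₀])))
    · exact det_sub_wedge_eq_zero m a _ _ (hspan _) (hne₁ j hj).symm (by rw [hv₁, hp₁])
        (by rw [hvj, hpN₁])
        (Or.inr (smallOmega_eq_zero m a (k := ⟨j - 2, by omega⟩) (i := 1) (by simp)
          (by rw [hj', hvj, hpN₁])))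

end
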